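/- For every integer p ≥ 2, every N ∈ ℕ, α > 0 and β > 0, with γ = α^{p−1}, the quenched pressure of the diluted p-spin model is differentiable in α and ∂A_N(α,β)/∂α = (p−1) α^{p−2} [ ln cosh β − ∑_{n=1}^∞ ((−1)^n/n) θ^n ⟨q_{1…n}^p⟩_N ], where θ = tanh β and the series converges absolutely. -/

import Mathlib

open scoped BigOperators

noncomputable section

/-- The Poisson probability mass function with mean `lam`. -/
def pois (lam : ℝ) (k : ℕ) : ℝ := Real.exp (-lam) * lam ^ k / (Nat.factorial k)

/-- The spin value (±1) attached to a Boolean opinion. -/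
def spin (b : Bool) : ℝ := if b then 1 else -1

/-- Average of `f` over `p` families of `k` i.i.d. indices, each uniform on `Fin N`. -/
def avgIdx (N : ℕ) (p k : ℕ) (f : (Fin p → Fin k → Fin N) → ℝ) : ℝ :=
  ((N : ℝ) ^ (p * k))⁻¹ * ∑ im : Fin p → Fin k → Fin N, f im

/-- The interaction sum `∑_{ν=1}^k σ_{i_ν^1} ⋯ σ_{i_ν^p}`; the Hamiltonian is its negative. -/
def intSum {N p k : ℕ} (im : Fin p → Fin k → Fin N) (σ : Fin N → Bool) : ℝ :=
  ∑ ν : Fin k, ∏ l : Fin p, spin (σ (im l ν))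

/-- The diluted `p`-spin Hamiltonian `H = -∑_{ν=1}^k σ_{i_ν^1} ⋯ σ_{i_ν^p}`. -/
def Hspin {N p k : ℕ} (im : Fin p → Fin k → Fin N) (σ : Fin N → Bool) : ℝ :=
  - intSum im σ

/-- Partition function `Z = ∑_σ e^{-β H(σ)}`. -/
def Zpart (β : ℝ) {N p k : ℕ} (im : Fin p → Fin k → Fin N) : ℝ :=
  ∑ σ : Fin N → Bool, Real.exp (β * intSum im σ)

/-- Cavity term `∑_{ν=1}^{k'} σ_{i_ν^1} ⋯ σ_{i_ν^q}` (with `q = p - 1` families). -/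
def cavSum {N q k' : ℕ} (im' : Fin q → Fin k' → Fin N) (σ : Fin N → Bool) : ℝ :=
  ∑ ν : Fin k', ∏ l : Fin q, spin (σ (im' l ν))

/-- Perturbed Boltzmann weight `exp(β(∑_ν σ_{i_ν^1}⋯σ_{i_ν^p} + ∑_ν σ_{i'_ν^1}⋯σ_{i'_ν^{q}}))`. -/
def wpert (β : ℝ) {N p k q k' : ℕ} (im : Fin p → Fin k → Fin N)
    (im' : Fin q → Fin k' → Fin N) (σ : Fin N → Bool) : ℝ :=
  Real.exp (β * (intSum im σ + cavSum im' σ))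

/-- Perturbed partition function. -/
def Zpert (β : ℝ) {N p k q k' : ℕ} (im : Fin p → Fin k → Fin N)
    (im' : Fin q → Fin k' → Fin N) : ℝ :=
  ∑ σ : Fin N → Bool, wpert β im im' σ

/-- Replicated (unperturbed) Boltzmann state `Ω(g)` on `s` replicas sharing the same disorder. -/
def OmegaB (β : ℝ) {N p k : ℕ} (im : Fin p → Fin k → Fin N)
    (s : ℕ) (g : (Fin s → Fin N → Bool) → ℝ) : ℝ :=
  (∑ σs : Fin s → Fin N → Bool, g σs * ∏ a : Fin s, Real.exp (β * intSum im (σs a))) /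
    (Zpart β im) ^ s

/-- Replicated perturbed Boltzmann state `Ω̃_t(g)` on `s` replicas sharing the same disorder. -/
def OmegaPert (β : ℝ) {N p k q k' : ℕ} (im : Fin p → Fin k → Fin N)
    (im' : Fin q → Fin k' → Fin N) (s : ℕ) (g : (Fin s → Fin N → Bool) → ℝ) : ℝ :=
  (∑ σs : Fin s → Fin N → Bool, g σs * ∏ a : Fin s, wpert β im im' (σs a)) /
    (Zpert β im im') ^ s

/-- Quenched expectation: the number of interaction terms is Poisson of mean `γ N` and the
`p` index families are i.i.d. uniform on `Fin N`. -/
def Equench (N p : ℕ) (γ : ℝ) (f : (k : ℕ) → (Fin p → Fin k → Fin N) → ℝ) : ℝ :=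
  ∑' k : ℕ, pois (γ * N) k * avgIdx N p k (fun im => f k im)

/-- Quenched expectation including the cavity randomness: the cavity term has a Poisson
number of terms of mean `2 γ t`, with `p - 1` independent uniform index families. -/
def EquenchCav (N p : ℕ) (γ t : ℝ)
    (f : (k : ℕ) → (Fin p → Fin k → Fin N) →
         (k' : ℕ) → (Fin (p - 1) → Fin k' → Fin N) → ℝ) : ℝ :=
  ∑' k : ℕ, pois (γ * N) k * avgIdx N p k (fun im =>
    ∑' k' : ℕ, pois (2 * γ * t) k' * avgIdx N (p - 1) k' (fun im' => f k im k' im'))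

/-- Quenched average of `ln Z_N`. -/
def ElnZ (N p : ℕ) (γ β : ℝ) : ℝ :=
  Equench N p γ (fun _ im => Real.log (Zpart β im))

/-- Quenched pressure `A_N = (1/N) E[ln Z_N]`. -/
def pressure (N p : ℕ) (γ β : ℝ) : ℝ :=
  (N : ℝ)⁻¹ * ElnZ N p γ β

/-- Cavity function `Ψ_N(t) = E[ln (Z_{N,t} / Z_N)]`. -/
def cavityFn (N p : ℕ) (γ β t : ℝ) : ℝ :=
  EquenchCav N p γ t (fun _ im _ im' => Real.log (Zpert β im im' / Zpart β im))

/-- The multi-overlap `q_{1…n} = (1/N) ∑_i σ_i^{(1)} ⋯ σ_i^{(n)}` of `n` replicas. -/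
def qOv (N n : ℕ) (σs : Fin n → Fin N → Bool) : ℝ :=
  (N : ℝ)⁻¹ * ∑ x : Fin N, ∏ a : Fin n, spin (σs a x)

/-- Total (quenched) average `⟨q_{1…n}^r⟩_N` of the `r`-th power of the `n`-replica overlap. -/
def qPowAvg (N p : ℕ) (γ β : ℝ) (n r : ℕ) : ℝ :=
  Equench N p γ (fun _ im => OmegaB β im n (fun σs => (qOv N n σs) ^ r))

/-- Perturbed total average `⟨q_{1…n}^r⟩_{N,t}` of the `r`-th power of the `n`-replica overlap. -/
def qPowAvgPert (N p : ℕ) (γ β t : ℝ) (n r : ℕ) : ℝ :=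
  EquenchCav N p γ t (fun _ im _ im' => OmegaPert β im im' n (fun σs => (qOv N n σs) ^ r))

end

lemma summable_pois (x : ℝ) : Summable (pois x) := by
  have := (Real.summable_pow_div_factorial x).mul_left (Real.exp (-x))
  exact this.congr fun k => by simp [pois, mul_div_assoc]

lemma tsum_pois (x : ℝ) : ∑' k, pois x k = 1 := by
  have h : ∑' k : ℕ, x ^ k / (k.factorial : ℝ) = Real.exp x := by
    rw [Real.exp_eq_exp_ℝ, NormedSpace.exp_eq_tsum_div]
  simp only [pois, mul_div_assoc, tsum_mul_left, h]
  rw [← Real.exp_add]; simp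

lemma pois_nonneg {x : ℝ} (hx : 0 ≤ x) (k : ℕ) : 0 ≤ pois x k := by
  unfold pois; positivity

/-- The derivative, in its mean, of a Poisson expectation of a sequence of at most geometric
growth is the expectation of the forward difference. -/
lemma hasDerivAt_tsum_pois {u : ℕ → ℝ} {A : ℝ} (hu : ∀ k, |u k| ≤ A * 2 ^ k) (x : ℝ) :
    HasDerivAt (fun y => ∑' k, pois y k * u k) (∑' k, pois x k * (u (k + 1) - u k)) x := by
  have hA : 0 ≤ A := by simpa using (abs_nonneg _).trans (hu 0)
  have hs0 (y : ℝ) : Summable fun k => y ^ k / (k.factorial : ℝ) * u k := by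
    refine .of_norm_bounded ((Real.summable_pow_div_factorial (|y| * 2)).mul_left A) fun k => ?_
    rw [norm_mul, norm_div, norm_pow, Real.norm_eq_abs, Real.norm_eq_abs (u k), mul_pow]
    simp only [Real.norm_natCast]
    calc _ ≤ |y| ^ k / (k.factorial : ℝ) * (A * 2 ^ k) := by gcongr; exact hu k
      _ = _ := by ring
  have hs1 (y : ℝ) : Summable fun k => y ^ k / (k.factorial : ℝ) * u (k + 1) := by
    refine .of_norm_bounded ((Real.summable_pow_div_factorial (|y| * 2)).mul_left (A * 2))
      fun k => ?_
    rw [norm_mul, norm_div, norm_pow, Real.norm_eq_abs, Real.norm_eq_abs (u _), mul_pow]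
    simp only [Real.norm_natCast]
    calc _ ≤ |y| ^ k / (k.factorial : ℝ) * (A * 2 ^ (k + 1)) := by gcongr; exact hu _
      _ = _ := by ring
  have hfac (k : ℕ) (y : ℝ) : ((k + 1 : ℕ) : ℝ) * y ^ k / ((k + 1).factorial : ℝ)
      = y ^ k / (k.factorial : ℝ) := by
    rw [Nat.factorial_succ]; push_cast
    have : (k.factorial : ℝ) ≠ 0 := by positivity
    field_simp
  have hG : HasDerivAt (fun y => ∑' k, y ^ k / (k.factorial : ℝ) * u k)
      (∑' k, x ^ k / (k.factorial : ℝ) * u (k + 1)) x := by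
    have hb : Summable fun k : ℕ =>
        (k : ℝ) * (|x| + 1) ^ (k - 1) / (k.factorial : ℝ) * |u k| := by
      rw [← summable_nat_add_iff 1]
      refine (hs1 (|x| + 1)).norm.congr fun k => ?_
      rw [add_tsub_cancel_right, hfac, norm_mul, Real.norm_eq_abs (u _),
        Real.norm_of_nonneg (by positivity)]
    have key := hasDerivAt_tsum_of_isPreconnected (t := Metric.ball (0 : ℝ) (|x| + 1))
      (g := fun k y => y ^ k / (k.factorial : ℝ) * u k)
      (g' := fun k y => (k : ℝ) * y ^ (k - 1) / (k.factorial : ℝ) * u k) (y₀ := x) (y := x)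
      hb Metric.isOpen_ball (convex_ball _ _).isPreconnected
      (fun k y _ => ((hasDerivAt_pow k y).div_const _).mul_const _)
      (fun k y hy => by
        have hy' : |y| ≤ |x| + 1 := by simpa using (Metric.mem_ball.mp hy).le
        rw [norm_mul, norm_div, norm_mul, norm_pow, Real.norm_eq_abs, Real.norm_eq_abs y,
          Real.norm_eq_abs (u k)]
        simp only [Real.norm_natCast, Nat.abs_cast]
        gcongr)
      (by simp) (hs0 x) (by simp)
    refine key.congr_deriv ?_
    have hsum : Summable fun k : ℕ => (k : ℝ) * x ^ (k - 1) / (k.factorial : ℝ) * u k := by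
      rw [← summable_nat_add_iff 1]
      refine (hs1 x).congr fun k => ?_
      rw [add_tsub_cancel_right, hfac]
    rw [hsum.tsum_eq_zero_add]
    simp only [add_tsub_cancel_right, hfac]
    simp
  have hE : HasDerivAt (fun y : ℝ => Real.exp (-y)) (-Real.exp (-x)) x := by
    simpa using (hasDerivAt_neg x).exp
  have hprod := hE.mul hG
  have e1 : (fun y => ∑' k, pois y k * u k) =
      (fun y : ℝ => Real.exp (-y)) * fun y => ∑' k, y ^ k / (k.factorial : ℝ) * u k := by
    ext y
    simp only [Pi.mul_apply, ← tsum_mul_left]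
    exact tsum_congr fun k => by simp only [pois]; ring
  rw [e1]
  refine hprod.congr_deriv ?_
  rw [neg_mul, ← tsum_mul_left, ← tsum_mul_left, neg_add_eq_sub,
    ← ((hs1 x).mul_left _).tsum_sub ((hs0 x).mul_left _)]
  exact tsum_congr fun k => by simp only [pois]; ring

lemma abs_prod_spin {ι : Type*} (s : Finset ι) (b : ι → Bool) :
    |∏ i ∈ s, spin (b i)| = 1 := by
  rw [Finset.abs_prod]
  exact Finset.prod_eq_one fun i _ => by unfold spin; split <;> simp

lemma exp_mul_of_abs_eq_one {β s : ℝ} (hs : |s| = 1) :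
    Real.exp (β * s) = Real.cosh β * (1 + Real.tanh β * s) := by
  have hc : Real.cosh β ≠ 0 := (Real.cosh_pos β).ne'
  rw [Real.tanh_eq_sinh_div_cosh]
  have h : Real.exp (β * s) = Real.cosh β + Real.sinh β * s := by
    rcases (abs_eq zero_le_one).mp hs with rfl | rfl
    · simp
    · simp [← sub_eq_add_neg]
  rw [h]
  field_simp

section AvgIdx

variable {N p k : ℕ}

lemma avgIdx_add (f g : (Fin p → Fin k → Fin N) → ℝ) :
    avgIdx N p k (fun im => f im + g im) = avgIdx N p k f + avgIdx N p k g := by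
  simp [avgIdx, Finset.sum_add_distrib, mul_add]

lemma avgIdx_sub (f g : (Fin p → Fin k → Fin N) → ℝ) :
    avgIdx N p k (fun im => f im - g im) = avgIdx N p k f - avgIdx N p k g := by
  simp [avgIdx, Finset.sum_sub_distrib, mul_sub]

lemma avgIdx_const (hN : 0 < N) (c : ℝ) : avgIdx N p k (fun _ => c) = c := by
  have : (N : ℝ) ≠ 0 := by positivity
  simp only [avgIdx, Finset.sum_const, Finset.card_univ, Fintype.card_pi, Finset.prod_const,
    Fintype.card_fin, nsmul_eq_mul]
  push_cast
  rw [← pow_mul, mul_comm k p]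
  field_simp

lemma abs_avgIdx_le (hN : 0 < N) {f : (Fin p → Fin k → Fin N) → ℝ} {C : ℝ}
    (hf : ∀ im, |f im| ≤ C) : |avgIdx N p k f| ≤ C := by
  calc |avgIdx N p k f| ≤ avgIdx N p k fun _ => C := by
        unfold avgIdx
        rw [abs_mul, abs_of_nonneg (by positivity)]
        gcongr
        exact (Finset.abs_sum_le_sum_abs _ _).trans (Finset.sum_le_sum fun im _ => hf im)
    _ = C := avgIdx_const hN C

lemma HasSum.avgIdx {F : ℕ → (Fin p → Fin k → Fin N) → ℝ} {f : (Fin p → Fin k → Fin N) → ℝ}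
    (h : ∀ im, HasSum (fun n => F n im) (f im)) :
    HasSum (fun n => avgIdx N p k (F n)) (avgIdx N p k f) :=
  (hasSum_sum fun im _ => h im).mul_left _

/-- Adding one index to each of the `p` families. -/
def consIdx (j : Fin p → Fin N) (im : Fin p → Fin k → Fin N) : Fin p → Fin (k + 1) → Fin N :=
  fun l => Fin.cons (j l) (im l)

lemma sum_consIdx (f : (Fin p → Fin (k + 1) → Fin N) → ℝ) :
    ∑ im, f im = ∑ im : Fin p → Fin k → Fin N, ∑ j, f (consIdx j im) := by
  rw [← Finset.sum_product', Finset.univ_product_univ]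
  refine (Finset.sum_nbij' (fun x => consIdx x.2 x.1)
    (fun im => (fun l ν => im l ν.succ, fun l => im l 0)) ?_ ?_ ?_ ?_ ?_).symm <;>
    simp [consIdx, funext_iff, Fin.forall_fin_succ]

lemma avgIdx_succ (f : (Fin p → Fin (k + 1) → Fin N) → ℝ) :
    avgIdx N p (k + 1) f =
      avgIdx N p k fun im => ((N : ℝ) ^ p)⁻¹ * ∑ j, f (consIdx j im) := by
  simp only [avgIdx, sum_consIdx, ← Finset.mul_sum]
  rw [← mul_assoc, mul_add_one, pow_add, mul_inv]

lemma intSum_consIdx (j : Fin p → Fin N) (im : Fin p → Fin k → Fin N) (σ : Fin N → Bool) :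
    intSum (consIdx j im) σ = ∏ l, spin (σ (j l)) + intSum im σ := by
  simp [intSum, consIdx, Fin.sum_univ_succ]

end AvgIdx

section Gibbs

variable {N p k : ℕ} (β : ℝ) (im : Fin p → Fin k → Fin N) (j : Fin p → Fin N)

lemma Zpart_pos : 0 < Zpart β im :=
  Finset.sum_pos (fun _ _ => Real.exp_pos _) Finset.univ_nonempty

/-- The Boltzmann average of the product of the spins at the sites `j`. -/
noncomputable def spinCorr : ℝ :=
  (∑ σ : Fin N → Bool, (∏ l, spin (σ (j l))) * Real.exp (β * intSum im σ)) / Zpart β im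

lemma abs_spinCorr_le_one : |spinCorr β im j| ≤ 1 := by
  rw [spinCorr, abs_div, abs_of_pos (Zpart_pos β im), div_le_one (Zpart_pos β im)]
  refine (Finset.abs_sum_le_sum_abs _ _).trans (Finset.sum_le_sum fun σ _ => ?_)
  rw [abs_mul, abs_prod_spin, one_mul, Real.abs_exp]

lemma Zpart_consIdx :
    Zpart β (consIdx j im) =
      Zpart β im * (Real.cosh β * (1 + Real.tanh β * spinCorr β im j)) := by
  have hZ := (Zpart_pos β im).ne'
  have h : Zpart β (consIdx j im) = Real.cosh β * (Zpart β im + Real.tanh β *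
      ∑ σ : Fin N → Bool, (∏ l, spin (σ (j l))) * Real.exp (β * intSum im σ)) := by
    simp only [Zpart, Finset.mul_sum, ← Finset.sum_add_distrib]
    refine Finset.sum_congr rfl fun σ _ => ?_
    rw [intSum_consIdx, mul_add, Real.exp_add, exp_mul_of_abs_eq_one (abs_prod_spin _ _)]
    ring
  rw [h, spinCorr]
  field_simp

lemma abs_tanh_mul_spinCorr_lt_one : |Real.tanh β * spinCorr β im j| < 1 := by
  rw [abs_mul]
  exact (mul_le_of_le_one_right (abs_nonneg _) (abs_spinCorr_le_one β im j)).trans_lt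
    (Real.abs_tanh_lt_one β)

lemma log_Zpart_consIdx :
    Real.log (Zpart β (consIdx j im)) = Real.log (Zpart β im) + (Real.log (Real.cosh β) +
      Real.log (1 + Real.tanh β * spinCorr β im j)) := by
  have h := (abs_lt.mp (abs_tanh_mul_spinCorr_lt_one β im j)).1
  have h1 : 0 < 1 + Real.tanh β * spinCorr β im j := by linarith
  have hc := Real.cosh_pos β
  rw [Zpart_consIdx, Real.log_mul (Zpart_pos β im).ne' (by positivity),
    Real.log_mul hc.ne' h1.ne']

lemma qOv_pow (n : ℕ) (σs : Fin n → Fin N → Bool) :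
    qOv N n σs ^ p =
      ((N : ℝ) ^ p)⁻¹ * ∑ j : Fin p → Fin N, ∏ a, ∏ l, spin (σs a (j l)) := by
  rw [qOv, mul_pow, Fintype.sum_pow, inv_pow]
  simp_rw [Finset.prod_comm (s := (Finset.univ : Finset (Fin n)))]

lemma OmegaB_qOv_pow (n : ℕ) :
    OmegaB β im n (fun σs => qOv N n σs ^ p) =
      ((N : ℝ) ^ p)⁻¹ * ∑ j, spinCorr β im j ^ n := by
  simp only [OmegaB, spinCorr, qOv_pow, div_pow, Fintype.sum_pow, ← Finset.sum_div,
    Finset.prod_mul_distrib]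
  rw [Finset.sum_comm, mul_div_assoc']
  simp only [Finset.mul_sum, Finset.sum_mul, mul_assoc]

lemma abs_site_average_le (hN : 0 < N) {f : (Fin p → Fin N) → ℝ} {C : ℝ}
    (hf : ∀ j, |f j| ≤ C) : |((N : ℝ) ^ p)⁻¹ * ∑ j, f j| ≤ C := by
  have hN' : (0 : ℝ) < (N : ℝ) ^ p := by positivity
  rw [abs_mul, abs_of_pos (inv_pos.mpr hN'), inv_mul_le_iff₀ hN']
  refine (Finset.abs_sum_le_sum_abs _ _).trans ((Finset.sum_le_sum fun j _ => hf j).trans ?_)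
  simp

lemma abs_OmegaB_qOv_pow_le_one (hN : 0 < N) (n : ℕ) :
    |OmegaB β im n (fun σs => qOv N n σs ^ p)| ≤ 1 := by
  rw [OmegaB_qOv_pow]
  refine abs_site_average_le hN fun j => ?_
  rw [abs_pow]
  exact pow_le_one₀ (abs_nonneg _) (abs_spinCorr_le_one β im j)

/-- The expansion of the mean increment of `log Z` under one extra interaction. -/
lemma hasSum_OmegaB_qOv_pow (hN : 0 < N) :
    HasSum (fun n : ℕ => ((-1 : ℝ) ^ (n + 1) / ((n : ℝ) + 1)) * Real.tanh β ^ (n + 1) *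
        OmegaB β im (n + 1) (fun σs => qOv N (n + 1) σs ^ p))
      (Real.log (Zpart β im) + Real.log (Real.cosh β) -
        ((N : ℝ) ^ p)⁻¹ * ∑ j, Real.log (Zpart β (consIdx j im))) := by
  have hN' : ((N : ℝ) ^ p) ≠ 0 := by positivity
  have h (j : Fin p → Fin N) := Real.hasSum_pow_div_log_of_abs_lt_one
    (x := -(Real.tanh β * spinCorr β im j))
    (by rw [abs_neg]; exact abs_tanh_mul_spinCorr_lt_one β im j)
  convert! (hasSum_sum fun j (_ : j ∈ Finset.univ) => h j).mul_left ((N : ℝ) ^ p)⁻¹ using 1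
  · ext n
    rw [OmegaB_qOv_pow, mul_left_comm, Finset.mul_sum]
    congr 1
    refine Finset.sum_congr rfl fun j _ => ?_
    rw [neg_pow (Real.tanh β * _), mul_pow]
    ring
  · simp only [log_Zpart_consIdx, Finset.sum_add_distrib, Finset.sum_const, Finset.card_univ,
      Fintype.card_pi, Finset.prod_const, Fintype.card_fin, nsmul_eq_mul, sub_neg_eq_add,
      Finset.sum_neg_distrib]
    push_cast
    field_simp
    ring

end Gibbs

section Increment

variable {N p : ℕ} (β : ℝ)

/-- The disorder average of `ln Z` conditioned on the number `k` of interactions. -/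
noncomputable def meanLogZ (N p : ℕ) (β : ℝ) (k : ℕ) : ℝ :=
  avgIdx N p k fun im => Real.log (Zpart β im)

/-- The disorder average of the `p`-th power of the `n`-replica overlap, conditioned on the
number `k` of interactions. -/
noncomputable def meanOverlapPow (N p : ℕ) (β : ℝ) (n k : ℕ) : ℝ :=
  avgIdx N p k fun im => OmegaB β im n (fun σs => qOv N n σs ^ p)

lemma abs_meanOverlapPow_le_one (hN : 0 < N) (n k : ℕ) : |meanOverlapPow N p β n k| ≤ 1 :=
  abs_avgIdx_le hN fun im => abs_OmegaB_qOv_pow_le_one β im hN n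

lemma hasSum_meanOverlapPow (hN : 0 < N) (k : ℕ) :
    HasSum (fun n : ℕ => ((-1 : ℝ) ^ (n + 1) / ((n : ℝ) + 1)) * Real.tanh β ^ (n + 1) *
        meanOverlapPow N p β (n + 1) k)
      (Real.log (Real.cosh β) - (meanLogZ N p β (k + 1) - meanLogZ N p β k)) := by
  have h := HasSum.avgIdx fun im : Fin p → Fin k → Fin N => hasSum_OmegaB_qOv_pow β im hN
  rw [avgIdx_sub, avgIdx_add, avgIdx_const hN,
    ← avgIdx_succ fun im => Real.log (Zpart β im)] at h
  convert! h using 1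
  · ext n
    simp only [meanOverlapPow, avgIdx, Finset.mul_sum]
    exact Finset.sum_congr rfl fun im _ => by ring
  · simp only [meanLogZ]
    ring

lemma abs_log_series_coeff_le (n : ℕ) :
    |((-1 : ℝ) ^ (n + 1) / ((n : ℝ) + 1)) * Real.tanh β ^ (n + 1)| ≤ |Real.tanh β| ^ n := by
  rw [abs_mul, abs_div, abs_pow, abs_pow, abs_neg, abs_one, one_pow, pow_succ,
    abs_of_pos (by positivity : (0 : ℝ) < n + 1)]
  have h1 : 1 / ((n : ℝ) + 1) ≤ 1 := by
    rw [div_le_one (by positivity)]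
    linarith [(Nat.cast_nonneg n : (0 : ℝ) ≤ n)]
  have h2 := (Real.abs_tanh_lt_one β).le
  calc _ ≤ 1 * (|Real.tanh β| ^ n * 1) := by gcongr
    _ = _ := by ring

lemma summable_abs_tanh_pow : Summable fun n : ℕ => |Real.tanh β| ^ n :=
  summable_geometric_of_lt_one (abs_nonneg _) (Real.abs_tanh_lt_one β)

lemma abs_log_series_term_le {x : ℝ} (hx : |x| ≤ 1) (n : ℕ) :
    |((-1 : ℝ) ^ (n + 1) / ((n : ℝ) + 1)) * Real.tanh β ^ (n + 1) * x| ≤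
      |Real.tanh β| ^ n := by
  rw [abs_mul]
  exact (mul_le_of_le_one_right (abs_nonneg _) hx).trans (abs_log_series_coeff_le β n)

lemma exists_abs_meanLogZ_le (hN : 0 < N) :
    ∃ A, ∀ k, |meanLogZ N p β k| ≤ A * 2 ^ k := by
  set C := |Real.log (Real.cosh β)| + ∑' n : ℕ, |Real.tanh β| ^ n
  have hstep (k : ℕ) : |meanLogZ N p β (k + 1) - meanLogZ N p β k| ≤ C := by
    have h := (hasSum_meanOverlapPow (p := p) β hN k).norm_le_of_bounded
      (summable_abs_tanh_pow β).hasSum fun n =>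
      abs_log_series_term_le β (abs_meanOverlapPow_le_one β hN (n + 1) k) n
    rw [Real.norm_eq_abs, abs_sub_comm] at h
    have := abs_add_le (Real.log (Real.cosh β))
      (meanLogZ N p β (k + 1) - meanLogZ N p β k - Real.log (Real.cosh β))
    rw [add_sub_cancel] at this
    linarith
  have hC : 0 ≤ C := (abs_nonneg _).trans (hstep 0)
  refine ⟨|meanLogZ N p β 0| + C, fun k => ?_⟩
  induction k with
  | zero => simpa using hC
  | succ k ih =>
    have h1 := abs_add_le (meanLogZ N p β k) (meanLogZ N p β (k + 1) - meanLogZ N p β k)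
    rw [add_sub_cancel] at h1
    have h2 : (1 : ℝ) ≤ 2 ^ k := one_le_pow₀ one_le_two
    have h3 : C * 1 ≤ (|meanLogZ N p β 0| + C) * 2 ^ k := by
      gcongr
      linarith [abs_nonneg (meanLogZ N p β 0)]
    rw [pow_succ]
    linarith [hstep k]

lemma abs_qPowAvg_le_one (hN : 0 < N) {γ : ℝ} (hγ : 0 ≤ γ) (n : ℕ) :
    |qPowAvg N p γ β n p| ≤ 1 := by
  have hl : 0 ≤ γ * N := by positivity
  rw [← tsum_pois (γ * N), qPowAvg, Equench, ← Real.norm_eq_abs]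
  refine tsum_of_norm_bounded (summable_pois _).hasSum fun k => ?_
  rw [norm_mul, Real.norm_of_nonneg (pois_nonneg hl k)]
  exact mul_le_of_le_one_right (pois_nonneg hl k) (abs_meanOverlapPow_le_one β hN n k)

lemma tsum_pois_meanLogZ_increment (hN : 0 < N) {γ : ℝ} (hγ : 0 ≤ γ) :
    ∑' k, pois (γ * N) k * (meanLogZ N p β (k + 1) - meanLogZ N p β k) =
      Real.log (Real.cosh β) -
        ∑' n : ℕ, ((-1 : ℝ) ^ (n + 1) / ((n : ℝ) + 1)) * Real.tanh β ^ (n + 1) *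
          qPowAvg N p γ β (n + 1) p := by
  have hl : 0 ≤ γ * N := by positivity
  set c : ℕ → ℝ := fun n => ((-1 : ℝ) ^ (n + 1) / ((n : ℝ) + 1)) * Real.tanh β ^ (n + 1)
  have hD (k : ℕ) : meanLogZ N p β (k + 1) - meanLogZ N p β k =
      Real.log (Real.cosh β) - ∑' n, c n * meanOverlapPow N p β (n + 1) k := by
    rw [(hasSum_meanOverlapPow β hN k).tsum_eq]
    ring
  have hS : Summable (Function.uncurry fun k n : ℕ =>
      pois (γ * N) k * (c n * meanOverlapPow N p β (n + 1) k)) := by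
    refine .of_norm_bounded ((summable_pois (γ * N)).mul_of_nonneg (summable_abs_tanh_pow β)
      (pois_nonneg hl) fun n => by positivity) fun x => ?_
    rw [Function.uncurry, norm_mul, Real.norm_of_nonneg (pois_nonneg hl _)]
    exact mul_le_mul_of_nonneg_left
      (abs_log_series_term_le β (abs_meanOverlapPow_le_one β hN _ _) _) (pois_nonneg hl _)
  have hS' : Summable fun k => ∑' n, pois (γ * N) k * (c n * meanOverlapPow N p β (n + 1) k) :=
    hS.prod
  simp only [hD, mul_sub, ← tsum_mul_left (a := pois (γ * N) _)]
  rw [((summable_pois _).mul_right _).tsum_sub hS', tsum_mul_right, tsum_pois, one_mul,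
    ← hS.tsum_comm]
  congr 1
  refine tsum_congr fun n => ?_
  rw [qPowAvg, Equench, ← tsum_mul_left]
  exact tsum_congr fun k => mul_left_comm _ _ _

end Increment

/-- `α`-streaming of the quenched pressure of the diluted `p`-spin model (`γ = α^{p-1}`):
`∂_α A_N(α,β) = (p-1) α^{p-2} [ln cosh β - ∑_{n≥1} ((-1)^n/n) θ^n ⟨q_{1…n}^p⟩_N]`,
with `θ = tanh β`, the series being absolutely convergent. -/
theorem pspin_pressure_alpha_derivative (p : ℕ) (hp : 2 ≤ p) (N : ℕ) (hN : 0 < N)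
    (α β : ℝ) (hα : 0 < α) (hβ : 0 < β) :
    Summable (fun n : ℕ =>
      |((-1 : ℝ) ^ (n + 1) / ((n : ℝ) + 1)) * Real.tanh β ^ (n + 1) *
        qPowAvg N p (α ^ (p - 1)) β (n + 1) p|) ∧
    HasDerivAt (fun a : ℝ => pressure N p (a ^ (p - 1)) β)
      (((p : ℝ) - 1) * α ^ (p - 2) *
        (Real.log (Real.cosh β) -
          ∑' n : ℕ, ((-1 : ℝ) ^ (n + 1) / ((n : ℝ) + 1)) * Real.tanh β ^ (n + 1) *
            qPowAvg N p (α ^ (p - 1)) β (n + 1) p)) α := by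
  have hγ : 0 ≤ α ^ (p - 1) := by positivity
  refine ⟨.of_nonneg_of_le (fun _ => abs_nonneg _)
    (fun n => abs_log_series_term_le β (abs_qPowAvg_le_one β hN hγ _) n)
    (summable_abs_tanh_pow β), ?_⟩
  obtain ⟨A, hA⟩ := exists_abs_meanLogZ_le (p := p) β hN
  have hmean : HasDerivAt (fun a : ℝ => a ^ (p - 1) * N)
      (((p - 1 : ℕ) : ℝ) * α ^ (p - 1 - 1) * N) α := (hasDerivAt_pow (p - 1) α).mul_const _
  have h := ((hasDerivAt_tsum_pois hA (α ^ (p - 1) * N)).comp α hmean).const_mul (N : ℝ)⁻¹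
  refine h.congr_deriv ?_
  rw [tsum_pois_meanLogZ_increment β hN hγ, Nat.sub_sub, Nat.cast_sub (by omega), Nat.cast_one]
  have hN' : (N : ℝ) ≠ 0 := by positivity
  field_simp
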